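/- arXiv:1806.07565 — 3 statements merged into one kernel-verified Lean document; each statement's English description precedes it below -/
import Mathlib

section
/- Under the given storage and computation constraints, the counts b_j satisfy the two inequalities: (i) \sum_{j=1}^{K-1} b_j \geq N(K - r), and (ii) \sum_{j=1}^{K-1} (j-1) b_j \leq (c-1) N K. (Lemma 3 of the paper.) -/
/-- **Lemma 3.** There are `K` nodes and `N` files. `M k` is the set of files stored at node
`k`; `Tc (k, n)` is the (nonempty) set of nodes computing the intermediate value `v_{k,n}`,
and a node can only compute `v_{k,n}` if it stores file `n`.
`b j` counts the pairs `(k,n)` such that `v_{k,n}` is not computed at node `k` and is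
computed by exactly `j` nodes. Under the storage constraint `∑ k, |M k| ≤ r N` and the
computation constraint `∑ (k,n), |T_{k,n}| ≤ c N K`, we have
`∑_{j=1}^{K-1} b j ≥ N (K - r)` and `∑_{j=1}^{K-1} (j-1) b j ≤ (c-1) N K`. -/
theorem stmt0 (K N : ℕ) (hK : 0 < K) (hN : 0 < N)
    (M : Fin K → Finset (Fin N))
    (Tc : Fin K × Fin N → Finset (Fin K))
    (hTne : ∀ i, (Tc i).Nonempty)
    (hTM : ∀ (i : Fin K × Fin N) (q : Fin K), q ∈ Tc i → i.2 ∈ M q)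
    (r c : ℝ)
    (hr : (∑ k, ((M k).card : ℝ)) ≤ r * N)
    (hc : (∑ i : Fin K × Fin N, ((Tc i).card : ℝ)) ≤ c * (N * K))
    (b : ℕ → ℕ)
    (hb : ∀ j, b j = (Finset.univ.filter
      (fun i : Fin K × Fin N => i.1 ∉ Tc i ∧ (Tc i).card = j)).card) :
    (N : ℝ) * ((K : ℝ) - r) ≤ (∑ j ∈ Finset.Icc 1 (K - 1), (b j : ℝ)) ∧
    (∑ j ∈ Finset.Icc 1 (K - 1), ((j : ℝ) - 1) * (b j : ℝ)) ≤ (c - 1) * (N * K) := by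
  have key : ∀ f : ℕ → ℝ, (∑ j ∈ Finset.Icc 1 (K - 1), f j * (b j : ℝ)) =
      ∑ i : Fin K × Fin N, if i.1 ∉ Tc i then f (Tc i).card else 0 := by
    intro f
    have h1 : ∀ j, f j * (b j : ℝ) = ∑ i : Fin K × Fin N,
        if j = (Tc i).card then (if i.1 ∉ Tc i then f (Tc i).card else 0) else 0 := by
      intro j
      rw [hb j, Finset.card_filter]
      push_cast
      rw [Finset.mul_sum]
      refine Finset.sum_congr rfl fun i _ => ?_
      by_cases h2 : j = (Tc i).card
      · subst h2
        by_cases h3 : i.1 ∈ Tc i <;> simp [h3]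
      · have h4 : ¬ (Tc i).card = j := fun h => h2 h.symm
        simp [h2, h4]
    simp_rw [h1]
    rw [Finset.sum_comm]
    refine Finset.sum_congr rfl fun i _ => ?_
    rw [Finset.sum_ite_eq' ]
    by_cases h3 : i.1 ∈ Tc i
    · simp [h3]
    · have hpos : 0 < (Tc i).card := (hTne i).card_pos
      have hlt : (Tc i).card < K := by
        have := Finset.card_lt_univ_of_notMem h3
        simpa using this
      rw [if_pos (Finset.mem_Icc.mpr ⟨hpos, by omega⟩)]
  constructor
  · have h := key (fun _ => 1)
    simp only [one_mul] at h
    rw [h]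
    have hM : (∑ k, ((M k).card : ℝ)) =
        ∑ i : Fin K × Fin N, if i.2 ∈ M i.1 then (1 : ℝ) else 0 := by
      rw [Fintype.sum_prod_type]
      refine Finset.sum_congr rfl fun k _ => ?_
      simp
    have hle : ∑ i : Fin K × Fin N, (1 - if i.2 ∈ M i.1 then (1 : ℝ) else 0) ≤
        ∑ i : Fin K × Fin N, if i.1 ∉ Tc i then (1 : ℝ) else 0 := by
      refine Finset.sum_le_sum fun i _ => ?_
      by_cases h3 : i.1 ∈ Tc i
      · simp [h3, hTM i _ h3]
      · by_cases h4 : i.2 ∈ M i.1 <;> simp [h3, h4]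
    rw [Finset.sum_sub_distrib, ← hM] at hle
    simp at hle
    simp
    nlinarith
  · rw [key (fun j => (j : ℝ) - 1)]
    have hle : (∑ i : Fin K × Fin N, if i.1 ∉ Tc i then ((Tc i).card : ℝ) - 1 else 0) ≤
        ∑ i : Fin K × Fin N, (((Tc i).card : ℝ) - 1) := by
      refine Finset.sum_le_sum fun i _ => ?_
      have hpos : (1 : ℝ) ≤ (Tc i).card := by exact_mod_cast (hTne i).card_pos
      split_ifs <;> linarith
    rw [Finset.sum_sub_distrib] at hle
    refine hle.trans ?_
    simp
    nlinarith
end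

section
/- For every nonempty subset S of [K], the conditional entropy of the transmitted signals of the nodes in S, given all intermediate values of the nodes outside S and all intermediate values computed by the nodes outside S, satisfies H( (X_q)_{q in S} | (V_{k,n})_{k in S^c, n in [N]}, (C_q)_{q in S^c} ) \geq T \sum_{j=1}^{|S|-1} b_{S,j} / j, where S^c = [K] \ S. (Lemma 2 of the paper.) -/
open scoped Classical

/-- Probability that the random variable `X` (on a finite probability space with weight
function `p`) takes the value `x`. -/
noncomputable def prOf {Ω α : Type*} [Fintype Ω] (p : Ω → ℝ) (X : Ω → α) (x : α) : ℝ :=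
  ∑ ω ∈ Finset.univ.filter (fun ω => X ω = x), p ω

/-- Shannon entropy (in bits) of the random variable `X` on a finite probability space
with weight function `p`. -/
noncomputable def entropy {Ω α : Type*} [Fintype Ω] (p : Ω → ℝ) (X : Ω → α) : ℝ :=
  -∑ x ∈ Finset.univ.image X, prOf p X x * Real.logb 2 (prOf p X x)

/-- Conditional Shannon entropy (in bits) `H(X | Y) = H(X, Y) - H(Y)`. -/
noncomputable def condEntropy {Ω α β : Type*} [Fintype Ω]
    (p : Ω → ℝ) (X : Ω → α) (Y : Ω → β) : ℝ :=
  entropy p (fun ω => (X ω, Y ω)) - entropy p Y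

section helpers

/-- Probability of the atom of `X` containing `ω`. -/
noncomputable def atomP {Ω α : Type*} [Fintype Ω] (p : Ω → ℝ) (X : Ω → α) (ω : Ω) : ℝ :=
  ∑ ω', if X ω' = X ω then p ω' else 0

/-- `X` determines `Y`. -/
def Det {Ω α β : Type*} (X : Ω → α) (Y : Ω → β) : Prop :=
  ∀ ω ω', X ω = X ω' → Y ω = Y ω'

lemma prOf_eq_atomP {Ω α : Type*} [Fintype Ω] (p : Ω → ℝ) (X : Ω → α) (ω : Ω) :
    prOf p X (X ω) = atomP p X ω := by
  simp [prOf, atomP, Finset.sum_filter]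

lemma entropy_eq {Ω α : Type*} [Fintype Ω] (p : Ω → ℝ) (X : Ω → α) :
    entropy p X = -∑ ω, p ω * Real.logb 2 (atomP p X ω) := by
  unfold entropy
  congr 1
  rw [← Finset.sum_fiberwise_of_maps_to (s := Finset.univ) (t := Finset.univ.image X) (g := X)
    (fun ω _ => Finset.mem_image_of_mem X (Finset.mem_univ ω))]
  refine Finset.sum_congr rfl fun x _ => ?_
  rw [prOf, Finset.sum_mul]
  refine Finset.sum_congr rfl fun ω hω => ?_
  have h : X ω = x := (Finset.mem_filter.1 hω).2
  rw [← prOf_eq_atomP, h, prOf]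

section
variable {Ω : Type*} [Fintype Ω] {p : Ω → ℝ}

lemma le_atomP (hp0 : ∀ ω, 0 ≤ p ω) {α : Type*} (X : Ω → α) (ω : Ω) : p ω ≤ atomP p X ω := by
  have := Finset.single_le_sum (f := fun ω' => if X ω' = X ω then p ω' else 0)
    (fun i _ => by split_ifs <;> simp [hp0]) (Finset.mem_univ ω)
  simpa [atomP] using this

lemma atomP_mono (hp0 : ∀ ω, 0 ≤ p ω) {α β : Type*} {X : Ω → α} {Y : Ω → β} (h : Det X Y)
    (ω : Ω) : atomP p X ω ≤ atomP p Y ω := by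
  refine Finset.sum_le_sum fun ω' _ => ?_
  by_cases h1 : X ω' = X ω
  · simp [h1, h _ _ h1]
  · simp only [h1, if_false]; split_ifs <;> simp [hp0]

lemma entropy_mono (hp0 : ∀ ω, 0 ≤ p ω) {α β : Type*} {X : Ω → α} {Y : Ω → β} (h : Det X Y) :
    entropy p Y ≤ entropy p X := by
  rw [entropy_eq, entropy_eq, neg_le_neg_iff]
  refine Finset.sum_le_sum fun ω _ => ?_
  rcases (hp0 ω).eq_or_lt with h0 | h0
  · simp [← h0]
  · refine mul_le_mul_of_nonneg_left ?_ h0.le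
    exact Real.logb_le_logb_of_le (by norm_num) (h0.trans_le (le_atomP hp0 X ω))
      (atomP_mono hp0 h ω)

lemma entropy_congr (hp0 : ∀ ω, 0 ≤ p ω) {α β : Type*} {X : Ω → α} {Y : Ω → β} (h : Det X Y)
    (h' : Det Y X) : entropy p Y = entropy p X :=
  le_antisymm (entropy_mono hp0 h) (entropy_mono hp0 h')

lemma atomP_nonneg (hp0 : ∀ ω, 0 ≤ p ω) {α : Type*} (X : Ω → α) (ω : Ω) : 0 ≤ atomP p X ω :=
  (hp0 ω).trans (le_atomP hp0 X ω)

lemma atomP_congr {α : Type*} {X : Ω → α} {ω ω' : Ω} (h : X ω = X ω') :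
    atomP p X ω = atomP p X ω' := by
  simp [atomP, h]

lemma key_sum (hp0 : ∀ ω, 0 ≤ p ω) {α β δ : Type*} {P : Ω → α} {Q : Ω → β}
    {R : Ω → δ} (hP : Det P R) (hQ : Det Q R) :
    ∑ ω, p ω * (atomP p P ω * atomP p Q ω /
      (atomP p (fun ω => (P ω, Q ω)) ω * atomP p R ω)) ≤ ∑ ω, p ω := by
  have e1 : ∀ ω, p ω * (atomP p P ω * atomP p Q ω /
      (atomP p (fun ω => (P ω, Q ω)) ω * atomP p R ω)) =
      ∑ ω1, ∑ ω2, if R ω2 = R ω1 then p ω1 * p ω2 / atomP p R ω1 *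
        (if P ω = P ω1 ∧ Q ω = Q ω2 then p ω / atomP p (fun ω => (P ω, Q ω)) ω else 0) else 0 := by
    intro ω
    have : p ω * (atomP p P ω * atomP p Q ω /
      (atomP p (fun ω => (P ω, Q ω)) ω * atomP p R ω)) = 
      (∑ ω1, if P ω1 = P ω then p ω1 else 0) * (∑ ω2, if Q ω2 = Q ω then p ω2 else 0) *
      (p ω / (atomP p (fun ω => (P ω, Q ω)) ω * atomP p R ω)) := by
      rw [atomP, atomP]; ring
    rw [this, Finset.sum_mul_sum, Finset.sum_mul]
    refine Finset.sum_congr rfl fun ω1 _ => ?_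
    rw [Finset.sum_mul]
    refine Finset.sum_congr rfl fun ω2 _ => ?_
    by_cases h1 : P ω = P ω1
    · by_cases h2 : Q ω = Q ω2
      · have h3 := hP _ _ h1
        have h4 := hQ _ _ h2
        have h5 : R ω2 = R ω1 := h4.symm.trans h3
        rw [if_pos h1.symm, if_pos h2.symm, if_pos h5, if_pos ⟨h1, h2⟩, atomP_congr (p := p) h3]
        simp only [div_eq_mul_inv, mul_inv]; ring
      · simp [h2, Ne.symm h2]
    · simp [h1, Ne.symm h1]
  rw [Finset.sum_congr rfl fun ω _ => e1 ω, Finset.sum_comm]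
  refine Finset.sum_le_sum fun ω1 _ => ?_
  rw [Finset.sum_comm]
  have e2 : ∀ ω2, (∑ ω, if R ω2 = R ω1 then p ω1 * p ω2 / atomP p R ω1 *
        (if P ω = P ω1 ∧ Q ω = Q ω2 then p ω / atomP p (fun ω => (P ω, Q ω)) ω else 0) else 0)
      ≤ (if R ω2 = R ω1 then p ω2 else 0) * (p ω1 / atomP p R ω1) := by
    intro ω2
    by_cases h : R ω2 = R ω1
    · simp only [h, if_true]
      rw [← Finset.mul_sum]
      have h1 : (∑ ω, if P ω = P ω1 ∧ Q ω = Q ω2 then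
          p ω / atomP p (fun ω => (P ω, Q ω)) ω else 0) ≤ 1 := by
        by_cases hex : ∃ ω0, P ω0 = P ω1 ∧ Q ω0 = Q ω2
        · obtain ⟨ω0, ha, hb⟩ := hex
          have : (∑ ω, if P ω = P ω1 ∧ Q ω = Q ω2 then
              p ω / atomP p (fun ω => (P ω, Q ω)) ω else 0) =
              atomP p (fun ω => (P ω, Q ω)) ω0 / atomP p (fun ω => (P ω, Q ω)) ω0 := by
            conv_rhs => rw [atomP.eq_1 p _ ω0]
            conv_rhs => rw [div_eq_mul_inv, Finset.sum_mul]
            refine Finset.sum_congr rfl fun ω _ => ?_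
            simp only [Prod.mk.injEq, ha, hb]
            by_cases hc : P ω = P ω1 ∧ Q ω = Q ω2
            · have : (fun ω => (P ω, Q ω)) ω = (fun ω => (P ω, Q ω)) ω0 := by
                simp [ha, hb, hc.1, hc.2]
              rw [if_pos hc, if_pos hc, atomP_congr (p := p) this, div_eq_mul_inv]
              simp [atomP, ha, hb]
            · simp [hc]
          rw [this]
          exact div_self_le_one _
        · push Not at hex
          rw [Finset.sum_eq_zero]
          · exact zero_le_one
          · intro ω _
            rw [if_neg]
            rintro ⟨ha, hb⟩
            exact hex ω ha hb
      have h2 : 0 ≤ p ω1 * p ω2 / atomP p R ω1 :=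
        div_nonneg (mul_nonneg (hp0 _) (hp0 _)) (atomP_nonneg hp0 _ _)
      calc _ ≤ p ω1 * p ω2 / atomP p R ω1 * 1 := mul_le_mul_of_nonneg_left h1 h2
        _ = _ := by ring
    · simp [h]
  refine (Finset.sum_le_sum fun ω2 _ => e2 ω2).trans ?_
  rw [← Finset.sum_mul, ← atomP]
  rcases (hp0 ω1).eq_or_lt with h0 | h0
  · simp [← h0]
  · have := h0.trans_le (le_atomP hp0 R ω1)
    rw [mul_div_cancel₀ _ this.ne']

lemma entropy_submod (hp0 : ∀ ω, 0 ≤ p ω) {α β δ : Type*} {P : Ω → α} {Q : Ω → β}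
    {R : Ω → δ} (hP : Det P R) (hQ : Det Q R) :
    entropy p (fun ω => (P ω, Q ω)) + entropy p R ≤ entropy p P + entropy p Q := by
  have key := key_sum hp0 hP hQ
  have hl2 : 0 < Real.log 2 := Real.log_pos (by norm_num)
  have h : ∑ ω, (p ω - p ω * (atomP p P ω * atomP p Q ω /
      (atomP p (fun ω => (P ω, Q ω)) ω * atomP p R ω))) ≤
      ∑ ω, Real.log 2 * (p ω * Real.logb 2 (atomP p (fun ω => (P ω, Q ω)) ω)
        + p ω * Real.logb 2 (atomP p R ω) - p ω * Real.logb 2 (atomP p P ω)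
        - p ω * Real.logb 2 (atomP p Q ω)) := by
    refine Finset.sum_le_sum fun ω _ => ?_
    rcases (hp0 ω).eq_or_lt with h0 | h0
    · simp [← h0]
    · have a1 := h0.trans_le (le_atomP hp0 P ω)
      have a2 := h0.trans_le (le_atomP hp0 Q ω)
      have a3 := h0.trans_le (le_atomP hp0 R ω)
      have a4 := h0.trans_le (le_atomP hp0 (fun ω => (P ω, Q ω)) ω)
      have := Real.log_le_sub_one_of_pos (div_pos (mul_pos a1 a2) (mul_pos a4 a3))
      rw [Real.log_div (by positivity) (by positivity), Real.log_mul a1.ne' a2.ne',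
        Real.log_mul a4.ne' a3.ne'] at this
      have e : Real.log 2 * (p ω * Real.logb 2 (atomP p (fun ω => (P ω, Q ω)) ω)
        + p ω * Real.logb 2 (atomP p R ω) - p ω * Real.logb 2 (atomP p P ω)
        - p ω * Real.logb 2 (atomP p Q ω)) = p ω * (Real.log (atomP p (fun ω => (P ω, Q ω)) ω)
        + Real.log (atomP p R ω) - Real.log (atomP p P ω) - Real.log (atomP p Q ω)) := by
        simp only [Real.logb]; field_simp
      rw [e]
      nlinarith
  rw [← Finset.mul_sum] at h
  simp only [Finset.sum_sub_distrib, Finset.sum_add_distrib] at h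
  simp only [entropy_eq]
  have : 0 ≤ Real.log 2 * _ := le_trans (by linarith) h
  have := nonneg_of_mul_nonneg_right this hl2
  linarith

end

lemma entropy_VA {Ω F ι : Type*} [Fintype Ω] [Fintype F] [Fintype ι] (T : ℕ)
    (hF : Fintype.card F = 2 ^ T)
    (p : Ω → ℝ) (hp1 : ∑ ω, p ω = 1) (V : ι → Ω → F)
    (hunif : ∀ (i : ι) (x : F), prOf p (V i) x = ((2 : ℝ) ^ T)⁻¹)
    (hindep : ∀ v : ι → F, prOf p (fun ω (i : ι) => V i ω) v = ∏ i : ι, prOf p (V i) (v i))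
    (A : Finset ι) : entropy p (fun ω (i : ↥A) => V i.1 ω) = T * A.card := by
  have h : ∀ ω, atomP p (fun ω (i : ↥A) => V i.1 ω) ω = (((2 : ℝ) ^ T)⁻¹) ^ A.card := by
    intro ω
    have e1 : atomP p (fun ω (i : ↥A) => V i.1 ω) ω =
        ∑ v ∈ Fintype.piFinset (fun i => if i ∈ A then {V i ω} else Finset.univ),
          prOf p (fun ω (i : ι) => V i ω) v := by
      simp only [prOf, Finset.sum_filter]
      rw [Finset.sum_comm, atomP]
      refine Finset.sum_congr rfl fun ω' _ => ?_
      rw [Finset.sum_ite_eq]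
      have hiff : ((fun i : ↥A => V i.1 ω') = fun i : ↥A => V i.1 ω) ↔
          (fun i => V i ω') ∈ Fintype.piFinset
            (fun i => if i ∈ A then {V i ω} else Finset.univ) := by
        rw [Fintype.mem_piFinset, funext_iff]
        constructor
        · intro h i
          by_cases hi : i ∈ A
          · simpa [hi] using h ⟨i, hi⟩
          · simp [hi]
        · intro h i
          simpa [i.2] using h i.1
      by_cases hc : ((fun i : ↥A => V i.1 ω') = fun i : ↥A => V i.1 ω)
      · rw [if_pos hc, if_pos (hiff.1 hc)]
      · rw [if_neg hc, if_neg (fun h => hc (hiff.2 h))]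
    rw [e1]
    simp only [hindep, hunif]
    rw [← Finset.prod_univ_sum (fun i => if i ∈ A then {V i ω} else Finset.univ)
      (fun _ _ => ((2 : ℝ) ^ T)⁻¹)]
    have : ∀ i, (∑ x ∈ (if i ∈ A then {V i ω} else Finset.univ : Finset F), ((2 : ℝ) ^ T)⁻¹) =
        if i ∈ A then ((2 : ℝ) ^ T)⁻¹ else 1 := by
      intro i
      split_ifs
      · simp
      · simp [hF]
    simp [this, Finset.prod_ite]
  rw [entropy_eq]
  simp only [h]
  rw [← Finset.sum_mul, hp1, Real.logb_pow, Real.logb_inv, Real.logb_pow,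
    Real.logb_self_eq_one (by norm_num)]
  ring

/-- The set of nodes computing `i`. -/
noncomputable def TT {K N : ℕ} (D : Fin K → Finset (Fin K × Fin N)) (i : Fin K × Fin N) :
    Finset (Fin K) := Finset.univ.filter (fun q : Fin K => i ∈ D q)

/-- Useful pairs. -/
def Good {K N : ℕ} (D : Fin K → Finset (Fin K × Fin N)) (S : Finset (Fin K))
    (i : Fin K × Fin N) : Prop := i.1 ∈ S ∧ TT D i ⊆ S.erase i.1

/-- The combinatorial right hand side. -/
noncomputable def RR {K N : ℕ} (D : Fin K → Finset (Fin K × Fin N)) (S : Finset (Fin K)) : ℝ :=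
  ∑ i : Fin K × Fin N, if Good D S i then ((TT D i).card : ℝ)⁻¹ else 0

/-- Index pairs known from outside `S`. -/
noncomputable def AA {K N : ℕ} (D : Fin K → Finset (Fin K × Fin N)) (S : Finset (Fin K)) :
    Finset (Fin K × Fin N) :=
  Finset.univ.filter (fun i => i.1 ∉ S ∨ ∃ q, q ∉ S ∧ i ∈ D q)

lemma RR_rec {K N : ℕ} (D : Fin K → Finset (Fin K × Fin N))
    (hTne : ∀ i : Fin K × Fin N, ∃ q : Fin K, i ∈ D q) (S : Finset (Fin K)) :
    ∑ k ∈ S, (RR D (S.erase k) +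
      ((Finset.univ.filter (fun i : Fin K × Fin N => i.1 = k ∧ Good D S i)).card : ℝ))
      = ((S.card : ℝ) - 1) * RR D S := by
  have e : ∀ k, ((Finset.univ.filter (fun i : Fin K × Fin N => i.1 = k ∧ Good D S i)).card : ℝ)
      = ∑ i : Fin K × Fin N, if i.1 = k ∧ Good D S i then (1 : ℝ) else 0 := by
    intro k; simp
  simp only [e, RR, ← Finset.sum_add_distrib]
  rw [Finset.sum_comm, Finset.mul_sum]
  refine Finset.sum_congr rfl fun i _ => ?_
  rw [Finset.sum_add_distrib]
  by_cases hg : Good D S i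
  · have hT0 : ((TT D i).card : ℝ) ≠ 0 := by
      obtain ⟨q, hq⟩ := hTne i
      have : (TT D i).Nonempty := ⟨q, by simp [TT, hq]⟩
      exact_mod_cast this.card_pos.ne'
    have h1 : ∑ k ∈ S, (if Good D (S.erase k) i then ((TT D i).card : ℝ)⁻¹ else 0)
        = ((S.card : ℝ) - 1 - (TT D i).card) * ((TT D i).card : ℝ)⁻¹ := by
      rw [← Finset.sum_filter, Finset.sum_const, nsmul_eq_mul]
      congr 1
      have : S.filter (fun k => Good D (S.erase k) i) = (S.erase i.1) \ TT D i := by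
        ext k
        simp only [Finset.mem_filter, Good, Finset.mem_sdiff, Finset.mem_erase]
        constructor
        · rintro ⟨a, ⟨b, c⟩, d⟩
          exact ⟨⟨Ne.symm b, a⟩, fun hk => by simpa using d hk⟩
        · rintro ⟨⟨a, b⟩, c⟩
          refine ⟨b, ⟨Ne.symm a, hg.1⟩, fun q hq => ?_⟩
          have := hg.2 hq
          simp only [Finset.mem_erase] at this ⊢
          exact ⟨this.1, fun h => c (h ▸ hq), this.2⟩
      rw [this, Finset.cast_card_sdiff hg.2, Finset.cast_card_erase_of_mem hg.1]
    have h2 : ∑ k ∈ S, (if i.1 = k ∧ Good D S i then (1 : ℝ) else 0) = 1 := by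
      simp [hg, hg.1]
    rw [h1, h2, if_pos hg]
    field_simp
    ring
  · have h3 : ∀ k, ¬ Good D (S.erase k) i := by
      intro k h
      refine hg ⟨Finset.mem_of_mem_erase h.1, fun q hq => ?_⟩
      have := h.2 hq
      simp only [Finset.mem_erase] at this ⊢
      exact ⟨this.1, this.2.2⟩
    simp [hg, h3]

lemma RR_rhs {K N : ℕ} (D : Fin K → Finset (Fin K × Fin N))
    (hTne : ∀ i : Fin K × Fin N, ∃ q : Fin K, i ∈ D q) (S : Finset (Fin K)) :
    ∑ j ∈ Finset.Icc 1 (S.card - 1),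
        ((∑ k ∈ S, (Finset.univ.filter (fun n : Fin N =>
            (Finset.univ.filter (fun q : Fin K => (k, n) ∈ D q)).card = j ∧
            (Finset.univ.filter (fun q : Fin K => (k, n) ∈ D q)) ⊆ S.erase k)).card : ℝ))
          / (j : ℝ) = RR D S := by
  rw [RR, Fintype.sum_prod_type]
  have e : ∀ k n, Finset.univ.filter (fun q : Fin K => (k, n) ∈ D q) = TT D (k, n) := 
    fun _ _ => rfl
  simp only [e, div_eq_mul_inv, Finset.sum_mul]
  rw [Finset.sum_comm, ← Finset.sum_subset (Finset.subset_univ S)]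
  · refine Finset.sum_congr rfl fun k hk => ?_
    have e2 : ∀ j : ℕ, ((Finset.univ.filter (fun n : Fin N => (TT D (k, n)).card = j ∧
        TT D (k, n) ⊆ S.erase k)).card : ℝ) * (j : ℝ)⁻¹ =
        ∑ n, if (TT D (k, n)).card = j ∧ TT D (k, n) ⊆ S.erase k then (j : ℝ)⁻¹ else 0 := by
      intro j
      rw [← Finset.sum_filter, Finset.sum_const, nsmul_eq_mul]
    simp only [e2]
    rw [Finset.sum_comm]
    refine Finset.sum_congr rfl fun n _ => ?_
    by_cases hs : TT D (k, n) ⊆ S.erase k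
    · have hg : Good D S (k, n) := ⟨hk, hs⟩
      have hm : (TT D (k, n)).card ∈ Finset.Icc 1 (S.card - 1) := by
        obtain ⟨q, hq⟩ := hTne (k, n)
        have : (TT D (k, n)).Nonempty := ⟨q, by simp [TT, hq]⟩
        rw [Finset.mem_Icc, ← Finset.card_erase_of_mem hk]
        exact ⟨this.card_pos, Finset.card_le_card hs⟩
      simp only [hs, and_true, if_pos hg]
      rw [Finset.sum_ite_eq, if_pos hm]
    · have hg : ¬ Good D S (k, n) := fun h => hs h.2
      simp [hs, hg]
  · intro k _ hk
    refine Finset.sum_eq_zero fun n _ => ?_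
    rw [if_neg]
    exact fun h => hk h.1

lemma entropy_sub_add {Ω : Type*} [Fintype Ω] {p : Ω → ℝ} (hp0 : ∀ ω, 0 ≤ p ω) {ι β : Type*}
    {γ : ι → Type*} (X : ∀ q, Ω → γ q) (Y : Ω → β) (R : Finset ι) :
    entropy p (fun ω => ((fun q : ↥R => X q.1 ω), Y ω)) - entropy p Y ≤
      ∑ k ∈ R, (entropy p (fun ω => (X k ω, Y ω)) - entropy p Y) := by
  induction R using Finset.induction_on with
  | empty =>
    have : entropy p (fun ω => ((fun q : ↥(∅ : Finset ι) => X q.1 ω), Y ω)) ≤ entropy p Y := by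
      refine entropy_mono hp0 fun ω ω' h => ?_
      simp only [Prod.mk.injEq, h, and_true]
      funext q
      exact absurd q.2 (Finset.notMem_empty _)
    simpa using this
  | insert a R ha ih =>
    rw [Finset.sum_insert ha]
    have h1 := entropy_submod hp0 (P := fun ω => (X a ω, Y ω))
      (Q := fun ω => ((fun q : ↥R => X q.1 ω), Y ω)) (R := Y)
      (fun ω ω' h => (Prod.mk.inj h).2) (fun ω ω' h => (Prod.mk.inj h).2)
    have h2 : entropy p (fun ω => ((fun q : ↥(insert a R) => X q.1 ω), Y ω)) ≤
        entropy p (fun ω => ((X a ω, Y ω), ((fun q : ↥R => X q.1 ω), Y ω))) := by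
      refine entropy_mono hp0 fun ω ω' h => ?_
      simp only [Prod.mk.injEq] at h ⊢
      refine ⟨?_, h.1.2⟩
      funext q
      obtain ⟨q, hq⟩ := q
      rcases Finset.mem_insert.1 hq with rfl | hq'
      · exact h.1.1
      · exact congrFun h.2.1 ⟨q, hq'⟩
    linarith

lemma main_ind {Ω F : Type*} [Fintype Ω] [Fintype F]
    (K N T : ℕ)
    (hF : Fintype.card F = 2 ^ T)
    (p : Ω → ℝ) (hp0 : ∀ ω, 0 ≤ p ω) (hp1 : ∑ ω, p ω = 1)
    (V : Fin K × Fin N → Ω → F)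
    (hunif : ∀ (i : Fin K × Fin N) (x : F), prOf p (V i) x = ((2 : ℝ) ^ T)⁻¹)
    (hindep : ∀ v : Fin K × Fin N → F,
      prOf p (fun ω (i : Fin K × Fin N) => V i ω) v = ∏ i : Fin K × Fin N, prOf p (V i) (v i))
    (D : Fin K → Finset (Fin K × Fin N))
    (hTne : ∀ i : Fin K × Fin N, ∃ q : Fin K, i ∈ D q)
    {γ : Fin K → Type*}
    (φ : ∀ q : Fin K, (↥(D q) → F) → γ q)
    (X : ∀ q : Fin K, Ω → γ q)
    (hX : ∀ (q : Fin K) (ω : Ω), X q ω = φ q (fun i => V i.1 ω))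
    (hdec : ∀ k : Fin K, ∃ ψ : (∀ q : Fin K, γ q) → (↥(D k) → F) → (Fin N → F),
      ∀ ω : Ω, ψ (fun q => X q ω) (fun i => V i.1 ω) = fun n => V (k, n) ω)
    (m : ℕ) : ∀ S : Finset (Fin K), S.card = m →
    T * RR D S ≤ entropy p (fun ω => ((fun q : ↥S => X q.1 ω), (fun i : ↥(AA D S) => V i.1 ω)))
      - T * (AA D S).card := by
  have hVA := entropy_VA T hF p hp1 V hunif hindep
  have hXdet : ∀ q ω ω', (∀ i ∈ D q, V i ω = V i ω') → X q ω = X q ω' := by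
    intro q ω ω' h
    rw [hX, hX]
    congr 1
    funext i
    exact h i.1 i.2
  induction m with
  | zero =>
    intro S hS
    obtain rfl := Finset.card_eq_zero.1 hS
    have : RR D ∅ = 0 := by simp [RR, Good]
    rw [this, ← hVA, mul_zero, sub_nonneg]
    exact entropy_mono hp0 fun ω ω' h => (Prod.mk.inj h).2
  | succ m ih =>
    intro S hS
    rcases Nat.eq_zero_or_pos m with rfl | hm
    · obtain ⟨k, rfl⟩ := Finset.card_eq_one.1 (by simpa using hS)
      have : RR D {k} = 0 := by
        refine Finset.sum_eq_zero fun i _ => ?_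
        rw [if_neg]
        rintro ⟨h1, h2⟩
        obtain ⟨q, hq⟩ := hTne i
        have := h2 (show q ∈ TT D i by simp [TT, hq])
        simp only [Finset.mem_singleton, Finset.mem_erase] at h1 this
        exact this.1 (this.2.trans h1.symm)
      rw [this, ← hVA, mul_zero, sub_nonneg]
      exact entropy_mono hp0 fun ω ω' h => (Prod.mk.inj h).2
    set Y : Ω → (↥(AA D S) → F) := fun ω i => V i.1 ω with hY
    have hYe : entropy p Y = T * (AA D S).card := hVA _
    have step : ∀ k ∈ S, T * (RR D (S.erase k) +
        ((Finset.univ.filter (fun i : Fin K × Fin N => i.1 = k ∧ Good D S i)).card : ℝ)) ≤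
        entropy p (fun ω => ((fun q : ↥S => X q.1 ω), Y ω)) - entropy p (fun ω => (X k ω, Y ω)) := by
      intro k hk
      have i1 := ih (S.erase k) (by rw [Finset.card_erase_of_mem hk, hS]; rfl)
      -- cardinalities
      have hsub : AA D S ∪ D k ⊆ AA D (S.erase k) := by
        intro i hi
        simp only [AA, Finset.mem_union, Finset.mem_filter, Finset.mem_univ, true_and,
          Finset.mem_erase, not_and] at hi ⊢
        rcases hi with (h | ⟨q, h1, h2⟩) | h
        · exact Or.inl fun _ => h
        · exact Or.inr ⟨q, fun _ => h1, h2⟩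
        · exact Or.inr ⟨k, fun h => absurd rfl h, h⟩
      have hdiff : AA D (S.erase k) \ (AA D S ∪ D k) =
          Finset.univ.filter (fun i : Fin K × Fin N => i.1 = k ∧ Good D S i) := by
        ext i
        simp only [AA, Good, TT, Finset.mem_sdiff, Finset.mem_union, Finset.mem_filter,
          Finset.mem_univ, true_and, Finset.mem_erase, not_and, Finset.subset_iff]
        constructor
        · rintro ⟨h1, h2⟩
          push Not at h2
          obtain ⟨⟨h2, h3⟩, h4⟩ := h2
          have hik : i.1 = k := by
            rcases h1 with h1 | ⟨q, h5, h6⟩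
            · by_contra hne
              exact h1 hne h2
            · by_cases hq : q = k
              · subst hq; exact absurd h6 h4
              · exact absurd h6 (h3 q (h5 hq))
          refine ⟨hik, h2, fun q hq => ⟨?_, ?_⟩⟩
          · rintro rfl
            rw [hik] at hq
            exact h4 hq
          · by_contra hqS
            exact h3 q hqS hq
        · rintro ⟨rfl, h1, h2⟩
          refine ⟨Or.inl fun h => absurd rfl h, ?_⟩
          push Not
          exact ⟨⟨h1, fun q hq hi => hq (h2 hi).2⟩, fun hi => (h2 hi).1 rfl⟩
      have hcard : ((Finset.univ.filter
          (fun i : Fin K × Fin N => i.1 = k ∧ Good D S i)).card : ℝ) =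
          (AA D (S.erase k)).card - (AA D S ∪ D k).card := by
        rw [← hdiff, Finset.cast_card_sdiff hsub]
      have hsm := entropy_submod hp0 (P := fun ω => ((fun q : ↥S => X q.1 ω), Y ω))
        (Q := fun ω (i : ↥(AA D S ∪ D k)) => V i.1 ω) (R := fun ω => (X k ω, Y ω))
        (by
          intro ω ω' h
          simp only [Prod.mk.injEq] at h ⊢
          exact ⟨congrFun h.1 ⟨k, hk⟩, h.2⟩)
        (by
          intro ω ω' h
          have h' : ∀ i ∈ AA D S ∪ D k, V i ω = V i ω' := fun i hi => congrFun h ⟨i, hi⟩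
          simp only [Prod.mk.injEq]
          refine ⟨hXdet k _ _ fun i hi => h' i (Finset.mem_union_right _ hi), ?_⟩
          funext i
          exact h' i.1 (Finset.mem_union_left _ i.2))
      have hmono : entropy p (fun ω => ((fun q : ↥(S.erase k) => X q.1 ω),
            (fun i : ↥(AA D (S.erase k)) => V i.1 ω))) ≤
          entropy p (fun ω => (((fun q : ↥S => X q.1 ω), Y ω),
            (fun (i : ↥(AA D S ∪ D k)) => V i.1 ω))) := by
        refine entropy_mono hp0 fun ω ω' h => ?_
        simp only [Prod.mk.injEq] at h ⊢
        obtain ⟨⟨h1, -⟩, h2⟩ := h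
        have h1' : ∀ q ∈ S, X q ω = X q ω' := fun q hq => congrFun h1 ⟨q, hq⟩
        have h2' : ∀ i ∈ AA D S ∪ D k, V i ω = V i ω' := fun i hi => congrFun h2 ⟨i, hi⟩
        have hXall : ∀ q, X q ω = X q ω' := by
          intro q
          by_cases hq : q ∈ S
          · exact h1' q hq
          · refine hXdet q _ _ fun i hi => h2' i (Finset.mem_union_left _ ?_)
            simp only [AA, Finset.mem_filter, Finset.mem_univ, true_and]
            exact Or.inr ⟨q, hq, hi⟩
        have hVk : ∀ n, V (k, n) ω = V (k, n) ω' := by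
          obtain ⟨ψ, hψ⟩ := hdec k
          have a := hψ ω
          have b := hψ ω'
          have c : (fun q => X q ω) = (fun q => X q ω') := funext hXall
          have d : (fun i : ↥(D k) => V i.1 ω) = (fun i : ↥(D k) => V i.1 ω') :=
            funext fun i => h2' i.1 (Finset.mem_union_right _ i.2)
          rw [c, d, b] at a
          exact fun n => (congrFun a n).symm
        refine ⟨funext fun q => hXall q.1, funext fun i => ?_⟩
        obtain ⟨i, hi⟩ := i
        by_cases hi2 : i ∈ AA D S ∪ D k
        · exact h2' i hi2
        · have : i ∈ AA D (S.erase k) \ (AA D S ∪ D k) := Finset.mem_sdiff.2 ⟨hi, hi2⟩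
          rw [hdiff] at this
          have hik := (Finset.mem_filter.1 this).2.1
          have := hVk i.2
          rw [← hik] at this
          exact this
      rw [hVA] at hsm
      rw [hcard, mul_add, mul_sub]
      linarith
    have hsum := Finset.sum_le_sum step
    rw [← Finset.mul_sum, RR_rec D hTne S, Finset.sum_sub_distrib, Finset.sum_const,
      nsmul_eq_mul] at hsum
    have hsa := entropy_sub_add hp0 X Y S
    rw [Finset.sum_sub_distrib, Finset.sum_const, nsmul_eq_mul] at hsa
    rw [← hYe]
    have hS' : (S.card : ℝ) = m + 1 := by rw [hS]; push_cast; rfl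
    rw [hS'] at hsum hsa
    have hm' : (0 : ℝ) < m := by exact_mod_cast hm
    refine le_of_mul_le_mul_left ?_ hm'
    nlinarith

end helpers

/-- **Lemma 2.** Setting: `V (k, n) : Ω → F` (with `|F| = 2^T`) are mutually independent and
uniformly distributed intermediate values; node `q` computes the intermediate values indexed by
`D q` (so `T_{k,n} = {q : (k,n) ∈ D q}` is the nonempty set of nodes computing `v_{k,n}`), and
multicasts the signal `X q = φ q ((V i)_{i ∈ D q})`; every node `k` can decode
`(V (k,1), …, V (k,N))` from all signals `X 1, …, X K` together with its locally computed
values `C k = (V i)_{i ∈ D k}`.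

Then for every nonempty `S ⊆ [K]`:
`H((X q)_{q ∈ S} | (V (k,n))_{k ∈ Sᶜ, n ∈ [N]}, (C q)_{q ∈ Sᶜ}) ≥ T ∑_{j=1}^{|S|-1} b_{S,j}/j`,
where `b_{S,j} = ∑_{k ∈ S} #{n : |T_{k,n}| = j ∧ T_{k,n} ⊆ S \ {k}}`. -/
theorem stmt3 {Ω F : Type*} [Fintype Ω] [Fintype F]
    (K N T : ℕ) (hK : 0 < K) (hN : 0 < N) (hT : 0 < T)
    (hF : Fintype.card F = 2 ^ T)
    (p : Ω → ℝ) (hp0 : ∀ ω, 0 ≤ p ω) (hp1 : ∑ ω, p ω = 1)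
    (V : Fin K × Fin N → Ω → F)
    (hunif : ∀ (i : Fin K × Fin N) (x : F), prOf p (V i) x = ((2 : ℝ) ^ T)⁻¹)
    (hindep : ∀ v : Fin K × Fin N → F,
      prOf p (fun ω (i : Fin K × Fin N) => V i ω) v = ∏ i : Fin K × Fin N, prOf p (V i) (v i))
    (D : Fin K → Finset (Fin K × Fin N))
    (hTne : ∀ i : Fin K × Fin N, ∃ q : Fin K, i ∈ D q)
    {γ : Fin K → Type*} [∀ q, Fintype (γ q)]
    (φ : ∀ q : Fin K, (↥(D q) → F) → γ q)
    (X : ∀ q : Fin K, Ω → γ q)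
    (hX : ∀ (q : Fin K) (ω : Ω), X q ω = φ q (fun i => V i.1 ω))
    (hdec : ∀ k : Fin K, ∃ ψ : (∀ q : Fin K, γ q) → (↥(D k) → F) → (Fin N → F),
      ∀ ω : Ω, ψ (fun q => X q ω) (fun i => V i.1 ω) = fun n => V (k, n) ω)
    (S : Finset (Fin K)) (hS : S.Nonempty) :
    condEntropy p
      (fun ω (q : ↥S) => X q.1 ω)
      (fun ω => ((fun i : ↥(Sᶜ) × Fin N => V (i.1.1, i.2) ω),
                 (fun (q : ↥(Sᶜ)) (i : ↥(D q.1)) => V i.1 ω)))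
    ≥ (T : ℝ) * ∑ j ∈ Finset.Icc 1 (S.card - 1),
        ((∑ k ∈ S, (Finset.univ.filter (fun n : Fin N =>
            (Finset.univ.filter (fun q : Fin K => (k, n) ∈ D q)).card = j ∧
            (Finset.univ.filter (fun q : Fin K => (k, n) ∈ D q)) ⊆ S.erase k)).card : ℝ))
          / (j : ℝ) := by
  have hVA := entropy_VA T hF p hp1 V hunif hindep
  have hmain := main_ind K N T hF p hp0 hp1 V hunif hindep D hTne φ X hX hdec S.card S rfl
  rw [ge_iff_le, RR_rhs D hTne S]
  refine hmain.trans ?_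
  rw [← hVA, condEntropy]
  have d1 : Det (fun ω => ((fun i : ↥(Sᶜ) × Fin N => V (i.1.1, i.2) ω),
                 (fun (q : ↥(Sᶜ)) (i : ↥(D q.1)) => V i.1 ω)))
      (fun ω (i : ↥(AA D S)) => V i.1 ω) := by
    intro ω ω' h
    simp only [Prod.mk.injEq] at h
    funext i
    obtain ⟨i, hi⟩ := i
    simp only [AA, Finset.mem_filter, Finset.mem_univ, true_and] at hi
    rcases hi with hi | ⟨q, hq, hi⟩
    · exact congrFun h.1 (⟨i.1, Finset.mem_compl.2 hi⟩, i.2)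
    · exact congrFun (congrFun h.2 ⟨q, Finset.mem_compl.2 hq⟩) ⟨i, hi⟩
  have d2 : Det (fun ω (i : ↥(AA D S)) => V i.1 ω)
      (fun ω => ((fun i : ↥(Sᶜ) × Fin N => V (i.1.1, i.2) ω),
                 (fun (q : ↥(Sᶜ)) (i : ↥(D q.1)) => V i.1 ω))) := by
    intro ω ω' h
    have h' : ∀ i ∈ AA D S, V i ω = V i ω' := fun i hi => congrFun h ⟨i, hi⟩
    simp only [Prod.mk.injEq]
    constructor
    · funext i
      refine h' _ ?_
      simp only [AA, Finset.mem_filter, Finset.mem_univ, true_and]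
      exact Or.inl (Finset.mem_compl.1 i.1.2)
    · funext q i
      refine h' _ ?_
      simp only [AA, Finset.mem_filter, Finset.mem_univ, true_and]
      exact Or.inr ⟨q.1, Finset.mem_compl.1 q.2, i.2⟩
  refine sub_le_sub (entropy_mono hp0 fun ω ω' h => ?_) (entropy_mono hp0 d2)
  have h := Prod.mk.inj h
  exact Prod.ext h.1 (d1 _ _ h.2)
end

section
/- For any map-shuffle-reduce scheme satisfying the storage constraint \sum_{k=1}^K |M_k| \leq r N and the computation constraint \sum_{q=1}^K |D_q| \leq c N K, and in which each signal X_q takes values in a set of cardinality at most 2^{l_q}, the total communication satisfies \sum_{q=1}^K l_q \geq N K T (lambda*c + mu). In particular the normalized communication load L = \sum_q l_q / (N K T) is at least lambda*c + mu. (Converse part of Theorem 1.) -/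
open scoped Classical

lemma exists_of_prOf_pos {Ω α : Type*} [Fintype Ω] (p : Ω → ℝ) (X : Ω → α) (x : α)
    (h : 0 < prOf p X x) : ∃ ω, X ω = x := by
  by_contra hcon
  push Not at hcon
  unfold prOf at h
  rw [Finset.filter_false_of_mem (fun ω _ => hcon ω)] at h
  simp at h

section EntropyHelpers

variable {G : Type*} [Fintype G]

/-- size of the class of `g`. -/
noncomputable def clsN (s : Setoid G) (g : G) : ℝ :=
  ((Finset.univ.filter (fun x => s g x)).card : ℝ)

/-- entropy of a partition under the uniform measure. -/
noncomputable def entS (s : Setoid G) : ℝ :=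
  (∑ g : G, (Real.log (Fintype.card G) - Real.log (clsN s g))) / Fintype.card G

lemma clsN_pos (s : Setoid G) (g : G) : 0 < clsN s g := by
  unfold clsN
  exact_mod_cast Finset.card_pos.mpr ⟨g, by simp [s.refl g]⟩

lemma clsN_congr (s : Setoid G) {g g' : G} (h : s g g') : clsN s g = clsN s g' := by
  unfold clsN
  congr 2
  ext x
  simp only [Finset.mem_filter, Finset.mem_univ, true_and]
  exact ⟨fun hx => s.trans (s.symm h) hx, fun hx => s.trans h hx⟩

lemma clsN_mono {s t : Setoid G} (h : s ≤ t) (g : G) : clsN s g ≤ clsN t g := by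
  unfold clsN
  exact_mod_cast Finset.card_le_card (fun x hx => by
    simp only [Finset.mem_filter, Finset.mem_univ, true_and] at hx ⊢
    exact h hx)

lemma entS_anti {s t : Setoid G} (h : s ≤ t) : entS t ≤ entS s := by
  unfold entS
  apply div_le_div_of_nonneg_right _ (by positivity)
  apply Finset.sum_le_sum
  intro g _
  have := Real.log_le_log (clsN_pos s g) (clsN_mono h g)
  linarith

lemma entS_top : entS (⊤ : Setoid G) = 0 := by
  unfold entS
  have : ∀ g : G, clsN (⊤ : Setoid G) g = Fintype.card G := by
    intro g
    unfold clsN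
    have : (Finset.univ.filter (fun x => (⊤ : Setoid G) g x)) = Finset.univ := by
      ext x; simp [Setoid.top_def]
    rw [this, Finset.card_univ]
  simp [this]

lemma sum_inv_cls (s : Setoid G) (x : G) :
    ∑ g ∈ Finset.univ.filter (fun g => s x g), (clsN s g)⁻¹ = 1 := by
  have : ∀ g ∈ Finset.univ.filter (fun g => s x g), (clsN s g)⁻¹ = (clsN s x)⁻¹ := by
    intro g hg
    simp only [Finset.mem_filter, Finset.mem_univ, true_and] at hg
    rw [clsN_congr s hg]
  rw [Finset.sum_congr rfl this, Finset.sum_const, nsmul_eq_mul]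
  exact mul_inv_cancel₀ (clsN_pos s x).ne'

lemma clsN_eq_sum (s : Setoid G) (g : G) : clsN s g = ∑ x : G, if s g x then (1:ℝ) else 0 := by
  unfold clsN
  simp

lemma key_sum_s13 (a b c : Setoid G) :
    ∑ g : G, clsN (a ⊓ c) g * clsN (b ⊓ c) g * ((clsN (a ⊓ b ⊓ c) g)⁻¹ * (clsN c g)⁻¹)
      ≤ Fintype.card G := by
  have h1 : ∀ g : G, clsN (a ⊓ c) g * clsN (b ⊓ c) g *
      ((clsN (a ⊓ b ⊓ c) g)⁻¹ * (clsN c g)⁻¹) =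
      ∑ x : G, ∑ y : G, if (a ⊓ c) g x ∧ (b ⊓ c) g y then
        ((clsN (a ⊓ b ⊓ c) g)⁻¹ * (clsN c g)⁻¹) else 0 := by
    intro g
    rw [clsN_eq_sum (a ⊓ c), clsN_eq_sum (b ⊓ c), Finset.sum_mul_sum, Finset.sum_mul]
    apply Finset.sum_congr rfl; intro x _
    rw [Finset.sum_mul]
    apply Finset.sum_congr rfl; intro y _
    by_cases h : (a ⊓ c) g x <;> by_cases h' : (b ⊓ c) g y <;> simp [h, h']
  rw [Finset.sum_congr rfl (fun g _ => h1 g), Finset.sum_comm]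
  have h2 : ∀ x : G, ∑ g : G, ∑ y : G, (if (a ⊓ c) g x ∧ (b ⊓ c) g y then
        ((clsN (a ⊓ b ⊓ c) g)⁻¹ * (clsN c g)⁻¹) else 0) ≤ 1 := by
    intro x
    rw [Finset.sum_comm]
    have h3 : ∀ y : G, ∑ g : G, (if (a ⊓ c) g x ∧ (b ⊓ c) g y then
        ((clsN (a ⊓ b ⊓ c) g)⁻¹ * (clsN c g)⁻¹) else 0) ≤
        (if c x y then (1:ℝ) else 0) * (clsN c x)⁻¹ := by
      intro y
      by_cases hE : ∃ g0 : G, (a ⊓ c) g0 x ∧ (b ⊓ c) g0 y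
      · obtain ⟨g0, ⟨ha, hcx⟩, ⟨hb, hcy⟩⟩ := hE
        have hxy : c x y := c.trans (c.symm hcx) hcy
        rw [if_pos hxy, one_mul, ← Finset.sum_filter]
        have hset : (Finset.univ.filter (fun g => (a ⊓ c) g x ∧ (b ⊓ c) g y)) =
            Finset.univ.filter (fun g => (a ⊓ b ⊓ c) g0 g) := by
          ext g
          simp only [Finset.mem_filter, Finset.mem_univ, true_and]
          constructor
          · rintro ⟨⟨h1, h2⟩, ⟨h3, h4⟩⟩
            exact ⟨⟨a.trans ha (a.symm h1), b.trans hb (b.symm h3)⟩, c.trans hcx (c.symm h2)⟩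
          · rintro ⟨⟨h1, h2⟩, h3⟩
            exact ⟨⟨a.trans (a.symm h1) ha, c.trans (c.symm h3) hcx⟩,
              ⟨b.trans (b.symm h2) hb, c.trans (c.symm h3) hcy⟩⟩
        rw [hset]
        have : ∀ g ∈ Finset.univ.filter (fun g => (a ⊓ b ⊓ c) g0 g),
            (clsN (a ⊓ b ⊓ c) g)⁻¹ * (clsN c g)⁻¹ =
            (clsN (a ⊓ b ⊓ c) g)⁻¹ * (clsN c x)⁻¹ := by
          intro g hg
          simp only [Finset.mem_filter, Finset.mem_univ, true_and] at hg
          rw [clsN_congr c (c.trans (c.symm hg.2) hcx)]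
        rw [Finset.sum_congr rfl this, ← Finset.sum_mul, sum_inv_cls, one_mul]
      · push Not at hE
        rw [Finset.sum_eq_zero]
        · have := (clsN_pos c x).le
          split_ifs <;> simp [this]
        · intro g _
          rw [if_neg]
          rintro ⟨h1, h2⟩
          exact hE g h1 h2
    refine (Finset.sum_le_sum (fun y _ => h3 y)).trans ?_
    rw [← Finset.sum_mul, ← clsN_eq_sum, mul_inv_cancel₀ (clsN_pos c x).ne']
  refine (Finset.sum_le_sum (fun x _ => h2 x)).trans ?_
  simp

lemma entS_submod (a b c : Setoid G) :
    entS (a ⊓ b ⊓ c) + entS c ≤ entS (a ⊓ c) + entS (b ⊓ c) := by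
  unfold entS
  rw [← add_div, ← add_div]
  apply div_le_div_of_nonneg_right _ (by positivity)
  rw [← Finset.sum_add_distrib, ← Finset.sum_add_distrib, ← sub_nonpos, ← Finset.sum_sub_distrib]
  have hk := key_sum_s13 a b c
  refine (Finset.sum_le_sum (g := fun g => clsN (a ⊓ c) g * clsN (b ⊓ c) g *
    ((clsN (a ⊓ b ⊓ c) g)⁻¹ * (clsN c g)⁻¹) - 1) (fun g _ => ?_)).trans ?_
  · have p1 := clsN_pos (a ⊓ c) g
    have p2 := clsN_pos (b ⊓ c) g
    have p3 := clsN_pos (a ⊓ b ⊓ c) g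
    have p4 := clsN_pos c g
    have := Real.log_le_sub_one_of_pos (x := clsN (a ⊓ c) g * clsN (b ⊓ c) g *
      ((clsN (a ⊓ b ⊓ c) g)⁻¹ * (clsN c g)⁻¹)) (by positivity)
    rw [Real.log_mul (by positivity) (by positivity), Real.log_mul (by positivity) (by positivity),
      Real.log_mul (by positivity) (by positivity), Real.log_inv, Real.log_inv] at this
    linarith
  · rw [Finset.sum_sub_distrib]
    simp only [Finset.sum_const, Finset.card_univ, nsmul_eq_mul, mul_one]
    linarith

lemma entS_ker_le {α : Type*} [Fintype α] [Nonempty G] (f : G → α) :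
    entS (Setoid.ker f) ≤ Real.log (Fintype.card α) := by
  have hG : (0:ℝ) < Fintype.card G := by exact_mod_cast Fintype.card_pos
  have : Nonempty α := ⟨f (Classical.arbitrary G)⟩
  have hA : (0:ℝ) < Fintype.card α := by exact_mod_cast Fintype.card_pos
  unfold entS
  rw [div_le_iff₀ hG, ← sub_nonpos]
  have e1 : Real.log (Fintype.card α) * (Fintype.card G : ℝ) =
      ∑ g : G, Real.log (Fintype.card α) := by simp [mul_comm]
  rw [e1, ← Finset.sum_sub_distrib]
  have hs : ∑ g : G, (clsN (Setoid.ker f) g)⁻¹ ≤ Fintype.card α := by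
    rw [← Finset.sum_fiberwise Finset.univ f]
    have : ∀ y : α, ∑ g ∈ Finset.univ.filter (fun g => f g = y), (clsN (Setoid.ker f) g)⁻¹ ≤ 1 := by
      intro y
      by_cases h : ∃ x, f x = y
      · obtain ⟨x, rfl⟩ := h
        have := sum_inv_cls (Setoid.ker f) x
        rw [← this]
        apply le_of_eq
        congr 1
        ext g
        simp [Setoid.ker_def, eq_comm]
      · push Not at h
        rw [Finset.filter_false_of_mem (by intro x _; exact h x)]
        simp
    refine (Finset.sum_le_sum (fun y _ => this y)).trans ?_
    simp
  refine (Finset.sum_le_sum (g := fun g => (Fintype.card G : ℝ) / Fintype.card α *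
    (clsN (Setoid.ker f) g)⁻¹ - 1) (fun g _ => ?_)).trans ?_
  · have p1 := clsN_pos (Setoid.ker f) g
    have := Real.log_le_sub_one_of_pos (x := (Fintype.card G : ℝ) / Fintype.card α *
      (clsN (Setoid.ker f) g)⁻¹) (by positivity)
    rw [Real.log_mul (by positivity) (by positivity), Real.log_div (by positivity) (by positivity),
      Real.log_inv] at this
    linarith
  · rw [Finset.sum_sub_distrib, ← Finset.mul_sum]
    simp only [Finset.sum_const, Finset.card_univ, nsmul_eq_mul, mul_one]
    have : (Fintype.card G : ℝ) / Fintype.card α * ∑ g : G, (clsN (Setoid.ker f) g)⁻¹ ≤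
        (Fintype.card G : ℝ) / Fintype.card α * Fintype.card α :=
      mul_le_mul_of_nonneg_left hs (by positivity)
    rw [div_mul_cancel₀ _ hA.ne'] at this
    linarith

lemma entS_subadd {ι : Type*} (x : ι → Setoid G) (y : Setoid G) (S : Finset ι) :
    entS (S.inf x ⊓ y) - entS y ≤ ∑ k ∈ S, (entS (x k ⊓ y) - entS y) := by
  induction S using Finset.induction_on with
  | empty => simp
  | insert a S ha ih =>
    rw [Finset.sum_insert ha, Finset.inf_insert]
    have := entS_submod (x a) (S.inf x) y
    linarith

end EntropyHelpers

section CoordHelpers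

variable {I F : Type*} [Fintype I] [DecidableEq I] [Fintype F]

/-- agreement on the coordinates in `A`. -/
def coordS (F : Type*) (A : Finset I) : Setoid (I → F) where
  r v w := ∀ i ∈ A, v i = w i
  iseqv := ⟨fun _ _ _ => rfl, fun h i hi => (h i hi).symm,
    fun h h' i hi => (h i hi).trans (h' i hi)⟩

lemma coordS_anti {A B : Finset I} (h : A ⊆ B) : coordS F B ≤ coordS F A :=
  fun _ _ hv i hi => hv i (h hi)

lemma coordS_union (A B : Finset I) : coordS F (A ∪ B) = coordS F A ⊓ coordS F B := by
  apply le_antisymm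
  · exact le_inf (coordS_anti Finset.subset_union_left) (coordS_anti Finset.subset_union_right)
  · rintro v w ⟨h1, h2⟩ i hi
    rcases Finset.mem_union.mp hi with h | h
    · exact h1 i h
    · exact h2 i h

lemma entS_coord [Nonempty F] (A : Finset I) :
    entS (coordS F A) = A.card * Real.log (Fintype.card F) := by
  have hF : (0:ℝ) < Fintype.card F := by exact_mod_cast Fintype.card_pos
  have hN : ∀ g : I → F, clsN (coordS F A) g = (Fintype.card F : ℝ) ^ (Aᶜ.card) := by
    intro g
    unfold clsN
    have : (Finset.univ.filter (fun x => (coordS F A) g x)) =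
        Fintype.piFinset (fun i => if i ∈ A then {g i} else (Finset.univ : Finset F)) := by
      ext v
      simp only [Finset.mem_filter, Finset.mem_univ, true_and, Fintype.mem_piFinset]
      constructor
      · intro h i
        by_cases hi : i ∈ A
        · simp [hi, h i hi]
        · simp [hi]
      · intro h i hi
        have := h i
        simp only [hi, if_true, Finset.mem_singleton] at this
        exact this.symm
    rw [this, Fintype.card_piFinset]
    have e : ∀ i, (if i ∈ A then {g i} else (Finset.univ : Finset F)).card =
        if i ∈ Aᶜ then Fintype.card F else 1 := by
      intro i; by_cases hi : i ∈ A <;> simp [hi]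
    rw [Finset.prod_congr rfl (fun i _ => e i), Finset.prod_ite_mem, Finset.univ_inter,
      Finset.prod_const]
    push_cast; rfl
  have hc : (Fintype.card I : ℝ) = A.card + Aᶜ.card := by
    exact_mod_cast (Finset.card_add_card_compl A).symm
  have hG : (0:ℝ) < Fintype.card (I → F) := by exact_mod_cast Fintype.card_pos
  unfold entS
  simp only [hN]
  rw [Finset.sum_const, Finset.card_univ, nsmul_eq_mul, mul_div_cancel_left₀ _ hG.ne',
    Fintype.card_fun]
  push_cast
  rw [Real.log_pow, Real.log_pow, hc]
  ring

end CoordHelpers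

section Converse

variable {K N : ℕ}

/-- nodes computing the value `i`. -/
noncomputable def tset (D : Fin K → Finset (Fin K × Fin N)) (i : Fin K × Fin N) :
    Finset (Fin K) := Finset.univ.filter (fun q => i ∈ D q)

/-- coordinates known outside `S`. -/
noncomputable def jset (D : Fin K → Finset (Fin K × Fin N)) (S : Finset (Fin K)) :
    Finset (Fin K × Fin N) :=
  Finset.univ.filter (fun i => i.1 ∉ S ∨ ∃ q, q ∉ S ∧ i ∈ D q)

/-- the lower bound functional. -/
noncomputable def fS (D : Fin K → Finset (Fin K × Fin N)) (S : Finset (Fin K)) : ℝ :=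
  ∑ i : Fin K × Fin N,
    if i.1 ∈ S ∧ tset D i ⊆ S ∧ i.1 ∉ tset D i then 1 / ((tset D i).card : ℝ) else 0

/-- number of new coordinates for `k`. -/
noncomputable def mS (D : Fin K → Finset (Fin K × Fin N)) (S : Finset (Fin K)) (k : Fin K) :
    Finset (Fin K × Fin N) :=
  Finset.univ.filter (fun i => i.1 = k ∧ tset D i ⊆ S ∧ i.1 ∉ tset D i)

lemma jset_erase (D : Fin K → Finset (Fin K × Fin N)) (S : Finset (Fin K)) (k : Fin K)
    (hk : k ∈ S) :
    jset D (S.erase k) = (jset D S ∪ D k) ∪ mS D S k ∧ Disjoint (jset D S ∪ D k) (mS D S k) := by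
  constructor
  · ext i
    simp only [jset, mS, tset, Finset.mem_union, Finset.mem_filter, Finset.mem_univ, true_and,
      Finset.mem_erase, Finset.subset_iff]
    constructor
    · rintro (h | ⟨q, hq, hi⟩)
      · by_cases h1 : i.1 = k
        · by_cases h2 : ∃ q, q ∉ S ∧ i ∈ D q
          · exact Or.inl (Or.inl (Or.inr h2))
          · push Not at h2
            by_cases h3 : i ∈ D k
            · exact Or.inl (Or.inr h3)
            · refine Or.inr ⟨h1, fun q hq => ?_, by rwa [h1]⟩
              by_contra h4
              exact h2 q h4 hq
        · exact Or.inl (Or.inl (Or.inl (fun h5 => h ⟨h1, h5⟩)))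
      · by_cases h1 : q = k
        · subst h1; exact Or.inl (Or.inr hi)
        · exact Or.inl (Or.inl (Or.inr ⟨q, fun h5 => hq ⟨h1, h5⟩, hi⟩))
    · rintro (((h | ⟨q, hq, hi⟩) | h) | ⟨h, _⟩)
      · exact Or.inl (fun h5 => h h5.2)
      · exact Or.inr ⟨q, fun h5 => hq h5.2, hi⟩
      · exact Or.inr ⟨k, fun h5 => h5.1 rfl, h⟩
      · exact Or.inl (fun h5 => h5.1 h)
  · rw [Finset.disjoint_left]
    intro i hi hm
    simp only [jset, mS, tset, Finset.mem_union, Finset.mem_filter, Finset.mem_univ, true_and,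
      Finset.subset_iff] at hi hm
    obtain ⟨h1, h2, h3⟩ := hm
    subst h1
    rcases hi with (h | ⟨q, hq, hi⟩) | h
    · exact h hk
    · exact hq (h2 hi)
    · exact h3 h

lemma fS_rec (D : Fin K → Finset (Fin K × Fin N)) (hT : ∀ i, (tset D i).Nonempty)
    (S : Finset (Fin K)) :
    ∑ k ∈ S, (fS D (S.erase k) + ((mS D S k).card : ℝ)) = ((S.card : ℝ) - 1) * fS D S := by
  have hm : ∀ k, ((mS D S k).card : ℝ) = ∑ i : Fin K × Fin N,
      if i.1 = k ∧ tset D i ⊆ S ∧ i.1 ∉ tset D i then (1:ℝ) else 0 := by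
    intro k; simp [mS]
  simp only [hm, fS]
  simp only [← Finset.sum_add_distrib]
  rw [Finset.sum_comm, Finset.mul_sum]
  apply Finset.sum_congr rfl
  intro i _
  have htp : (0:ℝ) < (tset D i).card := by exact_mod_cast (hT i).card_pos
  by_cases h : i.1 ∈ S ∧ tset D i ⊆ S ∧ i.1 ∉ tset D i
  · rw [if_pos h]
    obtain ⟨h1, h2, h3⟩ := h
    rw [Finset.sum_add_distrib]
    have e1 : ∑ k ∈ S, (if i.1 = k ∧ tset D i ⊆ S ∧ i.1 ∉ tset D i then (1:ℝ) else 0) = 1 := by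
      simp [h1, h2, h3]
    have e2 : ∑ k ∈ S, (if i.1 ∈ S.erase k ∧ tset D i ⊆ S.erase k ∧ i.1 ∉ tset D i then
        1 / ((tset D i).card : ℝ) else 0) =
        ((S \ insert i.1 (tset D i)).card : ℝ) * (1 / ((tset D i).card : ℝ)) := by
      rw [← Finset.sum_filter, Finset.sum_const, nsmul_eq_mul]
      congr 3
      ext k
      simp only [Finset.mem_filter, Finset.mem_sdiff, Finset.mem_insert, Finset.mem_erase,
        Finset.subset_erase]
      constructor
      · rintro ⟨a, b, c, d⟩
        refine ⟨a, ?_⟩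
        rintro (e | e)
        · exact b.1 e.symm
        · exact c.2 e
      · rintro ⟨a, b⟩
        push Not at b
        exact ⟨a, ⟨Ne.symm b.1, h1⟩, ⟨h2, b.2⟩, h3⟩
    have e3 : ((S \ insert i.1 (tset D i)).card : ℝ) = S.card - ((tset D i).card + 1) := by
      have hsub : insert i.1 (tset D i) ⊆ S := Finset.insert_subset h1 h2
      have := Finset.card_sdiff_add_card_eq_card hsub
      rw [Finset.card_insert_of_notMem h3] at this
      rw [eq_sub_iff_add_eq]
      exact_mod_cast this
    rw [e1, e2, e3]
    field_simp
    ring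
  · rw [if_neg h, mul_zero]
    apply Finset.sum_eq_zero
    intro k hk
    rw [if_neg, if_neg, add_zero]
    · rintro ⟨a, b, c⟩
      exact h ⟨a ▸ hk, b, c⟩
    · rintro ⟨a, b, c⟩
      exact h ⟨Finset.mem_of_mem_erase a, b.trans (Finset.erase_subset _ _), c⟩

variable {F : Type*} [Fintype F] [Nonempty F]

lemma main_ind_s13 (D : Fin K → Finset (Fin K × Fin N)) (hT : ∀ i, (tset D i).Nonempty)
    (x : Fin K → Setoid (Fin K × Fin N → F))
    (hx : ∀ k, coordS F (D k) ≤ x k)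
    (hdec : ∀ k, (Finset.univ.inf x) ⊓ coordS F (D k) ≤
      coordS F (Finset.univ.filter (fun i => i.1 = k)))
    (n : ℕ) : ∀ S : Finset (Fin K), S.card = n →
      Real.log (Fintype.card F) * fS D S ≤
      entS (Finset.univ.inf x ⊓ coordS F (jset D S)) - entS (coordS F (jset D S)) := by
  induction n with
  | zero =>
    intro S hS
    have : S = ∅ := Finset.card_eq_zero.mp hS
    subst this
    have : fS D ∅ = 0 := by simp [fS]
    rw [this, mul_zero, sub_nonneg]
    exact entS_anti inf_le_right
  | succ n ih =>
    intro S hS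
    set X := Finset.univ.inf x with hXdef
    set Y := coordS F (jset D S) with hY
    set L := Real.log (Fintype.card F) with hL
    rcases Nat.eq_zero_or_pos n with hn | hn
    · have : fS D S = 0 := by
        unfold fS
        apply Finset.sum_eq_zero
        intro i _
        rw [if_neg]
        rintro ⟨h1, h2, h3⟩
        obtain ⟨a, ha⟩ := Finset.card_eq_one.mp (by omega : S.card = 1)
        obtain ⟨q, hq⟩ := hT i
        have hq' := h2 hq
        rw [ha, Finset.mem_singleton] at h1 hq'
        rw [h1, ← hq'] at h3
        exact h3 hq
      rw [this, mul_zero, sub_nonneg]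
      exact entS_anti inf_le_right
    · have hXY : X ⊓ Y = S.inf x ⊓ Y := by
        apply le_antisymm
        · exact inf_le_inf_right _ (Finset.inf_mono (Finset.subset_univ S))
        · refine le_inf (Finset.le_inf fun k _ => ?_) inf_le_right
          by_cases hk : k ∈ S
          · exact inf_le_left.trans (Finset.inf_le hk)
          · refine inf_le_right.trans (le_trans (coordS_anti ?_) (hx k))
            intro i hi
            simp only [jset, Finset.mem_filter, Finset.mem_univ, true_and]
            exact Or.inr ⟨k, hk, hi⟩
      have hsub := entS_subadd x Y S
      rw [← hXY] at hsub
      have hstep : ∀ k ∈ S, L * fS D (S.erase k) + L * ((mS D S k).card : ℝ) ≤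
          entS (X ⊓ Y) - entS (x k ⊓ Y) := by
        intro k hk
        have h1 := entS_submod X (coordS F (D k)) (x k ⊓ Y)
        have hXk : X ≤ x k := Finset.inf_le (Finset.mem_univ k)
        have a1 : X ⊓ (x k ⊓ Y) = X ⊓ Y := by
          rw [← inf_assoc, inf_eq_left.mpr hXk]
        have a2 : coordS F (D k) ⊓ (x k ⊓ Y) = coordS F (jset D S ∪ D k) := by
          rw [← inf_assoc, inf_eq_left.mpr (hx k), coordS_union, inf_comm]
        obtain ⟨hj, hd⟩ := jset_erase D S k hk
        have a3 : X ⊓ coordS F (D k) ⊓ (x k ⊓ Y) = X ⊓ coordS F (jset D (S.erase k)) := by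
          rw [inf_assoc, a2, hj, coordS_union (jset D S ∪ D k)]
          apply le_antisymm
          · refine le_inf inf_le_left (le_inf inf_le_right ?_)
            refine le_trans (inf_le_inf_left X (coordS_anti Finset.subset_union_right)) ?_
            refine (hdec k).trans (coordS_anti ?_)
            intro i hi
            simp only [mS, Finset.mem_filter, Finset.mem_univ, true_and] at hi ⊢
            exact hi.1
          · exact inf_le_inf_left X inf_le_left
        rw [a1, a2, a3] at h1
        have h2 := ih (S.erase k) (by rw [Finset.card_erase_of_mem hk, hS]; rfl)
        have h3 : entS (coordS F (jset D (S.erase k))) =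
            entS (coordS F (jset D S ∪ D k)) + L * ((mS D S k).card : ℝ) := by
          rw [entS_coord, entS_coord, hj, Finset.card_union_of_disjoint hd]
          push_cast
          ring
        linarith
      have hsum := Finset.sum_le_sum hstep
      have hrec := fS_rec D hT S
      have e1 : ∑ k ∈ S, (L * fS D (S.erase k) + L * ((mS D S k).card : ℝ)) =
          L * (((S.card : ℝ) - 1) * fS D S) := by
        rw [← hrec, Finset.mul_sum]
        apply Finset.sum_congr rfl
        intros; ring
      rw [e1] at hsum
      rw [Finset.sum_sub_distrib] at hsum hsub
      simp only [Finset.sum_const, nsmul_eq_mul] at hsum hsub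
      have hc : (0:ℝ) < (S.card : ℝ) - 1 := by
        rw [hS]; push_cast
        have : (0:ℝ) < n := by exact_mod_cast hn
        linarith
      refine le_of_mul_le_mul_left ?_ hc
      nlinarith

end Converse

/-- **Converse part of Theorem 1.** Setting: `V (k, n) : Ω → F` (with `|F| = 2^T`) are
mutually independent uniform intermediate values; node `q` stores the files `M q` and computes
the intermediate values indexed by `D q ⊆ {(k,n) : n ∈ M q}` (each `T_{k,n} = {q : (k,n) ∈ D q}`
is nonempty); node `q` multicasts a signal `X q = φ q ((V i)_{i ∈ D q})` taking values in a set
`γ q` of cardinality at most `2 ^ l q`; and every node `k` can decode `(V (k,1), …, V (k,N))`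
from all the signals together with its locally computed values `C k`.

Under the storage constraint `∑ k, |M k| ≤ r N` and the computation constraint
`∑ q, |D q| ≤ c N K`, the total communication satisfies
`∑ q, l q ≥ N K T (lam * c + mu)`; in particular the normalized communication load
`L = (∑ q, l q) / (N K T)` is at least `lam * c + mu`. -/
theorem stmt13 {Ω F : Type*} [Fintype Ω] [Fintype F]
    (K N T : ℕ) (hK : 2 ≤ K) (hN : 0 < N) (hT : 0 < T)
    (hF : Fintype.card F = 2 ^ T)
    (p : Ω → ℝ) (hp0 : ∀ ω, 0 ≤ p ω) (hp1 : ∑ ω, p ω = 1)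
    (V : Fin K × Fin N → Ω → F)
    (hunif : ∀ (i : Fin K × Fin N) (x : F), prOf p (V i) x = ((2 : ℝ) ^ T)⁻¹)
    (hindep : ∀ v : Fin K × Fin N → F,
      prOf p (fun ω (i : Fin K × Fin N) => V i ω) v = ∏ i : Fin K × Fin N, prOf p (V i) (v i))
    (M : Fin K → Finset (Fin N))
    (D : Fin K → Finset (Fin K × Fin N))
    (hDM : ∀ (q : Fin K) (i : Fin K × Fin N), i ∈ D q → i.2 ∈ M q)
    (hTne : ∀ i : Fin K × Fin N, ∃ q : Fin K, i ∈ D q)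
    {γ : Fin K → Type*} [∀ q, Fintype (γ q)]
    (l : Fin K → ℕ)
    (hγ : ∀ q : Fin K, Fintype.card (γ q) ≤ 2 ^ l q)
    (φ : ∀ q : Fin K, (↥(D q) → F) → γ q)
    (X : ∀ q : Fin K, Ω → γ q)
    (hX : ∀ (q : Fin K) (ω : Ω), X q ω = φ q (fun i => V i.1 ω))
    (hdec : ∀ k : Fin K, ∃ ψ : (∀ q : Fin K, γ q) → (↥(D k) → F) → (Fin N → F),
      ∀ ω : Ω, ψ (fun q => X q ω) (fun i => V i.1 ω) = fun n => V (k, n) ω)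
    (r c : ℝ) (hr1 : 1 ≤ r) (hrK : r < K) (hc : 1 ≤ c)
    (hstore : (∑ k : Fin K, ((M k).card : ℝ)) ≤ r * N)
    (hcomp : (∑ q : Fin K, ((D q).card : ℝ)) ≤ c * (N * K))
    (g1 g2 : ℕ) (hg1 : 0 < g1) (hg2 : g2 = g1 + 1) (hg2K : g2 ≤ K - 1)
    (c1 c2 lam mu : ℝ)
    (hc1 : c1 = r / K + (1 - r / K) * g1)
    (hc2 : c2 = r / K + (1 - r / K) * g2)
    (hlam : lam = 1 / g2 - 1 / g1)
    (hmu : mu = c2 / g1 - c1 / g2) :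
    (N : ℝ) * K * T * (lam * c + mu) ≤ ∑ q : Fin K, (l q : ℝ) ∧
    lam * c + mu ≤ (∑ q : Fin K, (l q : ℝ)) / ((N : ℝ) * K * T) := by
  have hFpos : 0 < Fintype.card F := by rw [hF]; positivity
  have hFne : Nonempty F := Fintype.card_pos_iff.mp hFpos
  have hsurj : ∀ v : Fin K × Fin N → F, ∃ ω, ∀ i, V i ω = v i := by
    intro v
    have h1 := hindep v
    have h2 : 0 < prOf p (fun ω (i : Fin K × Fin N) => V i ω) v := by
      rw [h1]
      apply Finset.prod_pos
      intro i _
      rw [hunif]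
      positivity
    obtain ⟨ω, hω⟩ := exists_of_prOf_pos p _ v h2
    exact ⟨ω, fun i => congrFun hω i⟩
  let sig : ∀ q : Fin K, (Fin K × Fin N → F) → γ q := fun q v => φ q (fun i => v i.1)
  let x : Fin K → Setoid (Fin K × Fin N → F) := fun q => Setoid.ker (sig q)
  have hx : ∀ k, coordS F (D k) ≤ x k := by
    intro k v w h
    show φ k _ = φ k _
    congr 1
    funext i
    exact h i.1 i.2
  have hTn : ∀ i, (tset D i).Nonempty := by
    intro i
    obtain ⟨q, hq⟩ := hTne i
    exact ⟨q, by simp [tset, hq]⟩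
  have hdec' : ∀ k, (Finset.univ.inf x) ⊓ coordS F (D k) ≤
      coordS F (Finset.univ.filter (fun i => i.1 = k)) := by
    rintro k v w ⟨h1, h2⟩ ⟨k', n⟩ hi
    simp only [Finset.mem_filter, Finset.mem_univ, true_and] at hi
    subst hi
    obtain ⟨ψ, hψ⟩ := hdec k'
    obtain ⟨ω, hω⟩ := hsurj v
    obtain ⟨ω', hω'⟩ := hsurj w
    have e1 := hψ ω
    have e2 := hψ ω'
    have s1 : (fun q => X q ω) = fun q => X q ω' := by
      funext q
      rw [hX, hX]
      simp only [hω, hω']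
      have : x q v w := (Finset.inf_le (f := x) (Finset.mem_univ q)) h1
      exact this
    have s2 : (fun i : ↥(D k') => V i.1 ω) = fun i => V i.1 ω' := by
      funext i
      rw [hω, hω']
      exact h2 i.1 i.2
    rw [s1, s2, e2] at e1
    have := congrFun e1 n
    simp only [hω, hω'] at this
    exact this.symm
  have hmain := main_ind_s13 D hTn x hx hdec' K Finset.univ (by simp)
  have hj : coordS F (jset D Finset.univ) = ⊤ := by
    rw [eq_top_iff]
    intro v w _ i hi
    simp [jset] at hi
  rw [hj, inf_top_eq, entS_top, sub_zero] at hmain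
  have hub := entS_subadd x ⊤ Finset.univ
  simp only [inf_top_eq, entS_top, sub_zero] at hub
  have hlog2 : 0 < Real.log 2 := Real.log_pos (by norm_num)
  have hq : ∀ q, entS (x q) ≤ l q * Real.log 2 := by
    intro q
    refine (entS_ker_le (sig q)).trans ?_
    have hne : 0 < Fintype.card (γ q) :=
      Fintype.card_pos_iff.mpr ⟨sig q (fun _ => Classical.arbitrary F)⟩
    rw [← Real.log_pow]
    apply Real.log_le_log (by exact_mod_cast hne)
    exact_mod_cast hγ q
  have hub2 := hub.trans (Finset.sum_le_sum fun q _ => hq q)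
  rw [← Finset.sum_mul] at hub2
  have hlF : Real.log (Fintype.card F) = T * Real.log 2 := by
    rw [hF]; push_cast; rw [Real.log_pow]
  rw [hlF] at hmain
  have hB : (T : ℝ) * fS D Finset.univ ≤ ∑ q : Fin K, (l q : ℝ) := by
    refine le_of_mul_le_mul_right ?_ hlog2
    linarith
  -- the combinatorial part
  have hg1' : (0:ℝ) < g1 := by exact_mod_cast hg1
  have hg2r : (g2 : ℝ) = g1 + 1 := by rw [hg2]; push_cast; ring
  have hK' : (0:ℝ) < K := by exact_mod_cast (by omega : 0 < K)
  have hN' : (0:ℝ) < N := by exact_mod_cast hN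
  have hT' : (0:ℝ) < T := by exact_mod_cast hT
  have hlamneg : lam ≤ 0 := by
    rw [hlam, hg2r, sub_nonpos]
    exact one_div_le_one_div_of_le hg1' (by linarith)
  set β : ℝ := 1 / g1 + 1 / g2 with hβ
  have hlin : ∀ t : ℕ, 0 < t → lam * t + β ≤ 1 / (t : ℝ) := by
    intro t ht
    have ht' : (0:ℝ) < t := by exact_mod_cast ht
    have hz : (0:ℝ) ≤ ((t:ℝ) - g1) * (t - (g1 + 1)) := by
      have : (0:ℤ) ≤ ((t:ℤ) - g1) * (t - (g1 + 1)) := by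
        rcases le_or_gt (t:ℤ) g1 with h | h
        · exact mul_nonneg_of_nonpos_of_nonpos (by omega) (by omega)
        · exact mul_nonneg (by omega) (by omega)
      exact_mod_cast this
    have : 1 / (t : ℝ) - (lam * t + β) = ((t:ℝ) - g1) * (t - (g1 + 1)) / (t * g1 * (g1 + 1)) := by
      rw [hlam, hβ, hg2r]
      field_simp
      ring
    have h2 : 0 ≤ ((t:ℝ) - g1) * (t - (g1 + 1)) / (t * g1 * (g1 + 1)) := by positivity
    linarith
  have hpt : ∀ i : Fin K × Fin N,
      lam * (tset D i).card + β - (if i.1 ∈ tset D i then lam + β else 0) ≤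
      (if i.1 ∈ (Finset.univ : Finset (Fin K)) ∧ tset D i ⊆ Finset.univ ∧ i.1 ∉ tset D i then
        1 / ((tset D i).card : ℝ) else 0) := by
    intro i
    have hc0 := (hTn i).card_pos
    by_cases h : i.1 ∈ tset D i
    · have h1 : (1:ℝ) ≤ (tset D i).card := by exact_mod_cast hc0
      simp only [h, if_true, not_true, and_false, if_false]
      nlinarith
    · simp only [h, if_false, Finset.mem_univ, Finset.subset_univ, not_false_eq_true, and_self,
        if_true, sub_zero]
      exact hlin _ hc0
  have hsum := Finset.sum_le_sum (fun i (_ : i ∈ Finset.univ) => hpt i)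
  change _ ≤ fS D Finset.univ at hsum
  rw [Finset.sum_sub_distrib, Finset.sum_add_distrib, ← Finset.mul_sum, ← Finset.sum_filter] at hsum
  simp only [Finset.sum_const, nsmul_eq_mul, Finset.card_univ, Fintype.card_prod,
    Fintype.card_fin, Nat.cast_mul] at hsum
  have hcount : ∑ i : Fin K × Fin N, ((tset D i).card : ℝ) = ∑ q, ((D q).card : ℝ) := by
    have e1 : ∀ i : Fin K × Fin N, ((tset D i).card : ℝ) =
        ∑ q : Fin K, if i ∈ D q then (1:ℝ) else 0 := by
      intro i; simp [tset]
    have e2 : ∀ q : Fin K, ((D q).card : ℝ) =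
        ∑ i : Fin K × Fin N, if i ∈ D q then (1:ℝ) else 0 := by
      intro q; simp
    simp only [e1, e2]
    exact Finset.sum_comm
  have hU : ((Finset.univ.filter (fun i : Fin K × Fin N => i.1 ∈ tset D i)).card : ℝ) ≤ r * N := by
    refine le_trans ?_ hstore
    have : (Finset.univ.filter (fun i : Fin K × Fin N => i.1 ∈ tset D i)).card ≤
        (Finset.univ.sigma (fun k : Fin K => M k)).card := by
      apply Finset.card_le_card_of_injOn (fun i => (⟨i.1, i.2⟩ : Σ _ : Fin K, Fin N))
      · intro i hi
        simp only [tset, Finset.coe_filter, Finset.mem_filter, Finset.mem_univ, true_and,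
          Set.mem_setOf_eq] at hi
        simp only [Finset.coe_sigma, Set.mem_sigma_iff, Finset.mem_coe, Finset.mem_univ, true_and]
        exact hDM _ _ hi
      · rintro ⟨a, b⟩ _ ⟨a', b'⟩ _ h
        simpa using h
    rw [Finset.card_sigma] at this
    exact_mod_cast this
  rw [hcount] at hsum
  have hlb : 0 ≤ lam + β := by
    have : lam + β = 2 / g2 := by rw [hlam, hβ]; ring
    rw [this]; positivity
  have hfin : (N:ℝ) * K * (lam * c + mu) ≤ fS D Finset.univ := by
    have h1 : lam * (c * (N * K)) ≤ lam * ∑ q, ((D q).card : ℝ) :=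
      mul_le_mul_of_nonpos_left hcomp hlamneg
    have h2 := mul_le_mul_of_nonneg_right hU hlb
    have h3 : (N:ℝ) * K * (lam * c + mu) =
        lam * (c * (N * K)) + K * N * β - r * N * (lam + β) := by
      rw [hmu, hc1, hc2, hβ, hlam, hg2r]
      field_simp
      ring
    linarith
  have hres : (N : ℝ) * K * T * (lam * c + mu) ≤ ∑ q : Fin K, (l q : ℝ) := by
    refine le_trans ?_ hB
    have := mul_le_mul_of_nonneg_left hfin hT'.le
    linarith
  refine ⟨hres, ?_⟩
  rw [le_div_iff₀ (by positivity)]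
  linarith
end
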